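/- arXiv:2506.07299 — 7 statements merged into one kernel-verified Lean document; each statement's English description precedes it below -/
import Mathlib

section
/- Let λ > 0, μ ∈ ℝ, σ > 0, N ≥ 1, and let μ̂ and ΔS be independent real random variables with laws Gaussian of mean μ and variance σ²/N, and Gaussian of mean μ and variance σ², respectively. Then for every x ∈ ℝ, the mean-variance objective of the scaled product satisfies 𝔼[x·μ̂·ΔS] − (λ/2)·Var(x·μ̂·ΔS) = x·μ²·(1 − λ·x·σ²/2) − (λ/(2N))·x²·σ²·(μ² + σ²). -/
open MeasureTheory ProbabilityTheory
open scoped NNReal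

lemma gaussian_moments_aux {Ω : Type*} [MeasurableSpace Ω] (P : Measure Ω)
    [IsProbabilityMeasure P] (X : Ω → ℝ) (m : ℝ) (v : ℝ≥0)
    (h : Measure.map X P = gaussianReal m v) :
    AEMeasurable X P ∧ MemLp X 2 P ∧ ∫ ω, X ω ∂P = m ∧ ∫ ω, X ω ^ 2 ∂P = m ^ 2 + v := by
  have hX : AEMeasurable X P := by
    apply AEMeasurable.of_map_ne_zero
    rw [h]
    exact IsProbabilityMeasure.ne_zero _
  have hL : MemLp X 2 P := by
    have := memLp_id_gaussianReal' (μ := m) (v := v) 2 (by simp)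
    rw [← h, memLp_map_measure_iff aestronglyMeasurable_id hX] at this
    exact this
  have h1 : ∫ ω, X ω ∂P = m := by
    have := integral_map (f := fun x : ℝ => x) hX aestronglyMeasurable_id
    rw [← this, h, integral_id_gaussianReal]
  refine ⟨hX, hL, h1, ?_⟩
  have hv : variance X P = v := by
    have := variance_id_map hX
    rw [← this, h, variance_id_gaussianReal]
  have := variance_eq_sub hL
  rw [hv, h1] at this
  simp only [Pi.pow_apply] at this
  linarith

/-- With `μ̂ ~ N(μ, σ²/N)` and `ΔS ~ N(μ, σ²)` independent, the
mean-variance objective of `x·μ̂·ΔS` equals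
`x·μ²·(1 − λ·x·σ²/2) − (λ/(2N))·x²·σ²·(μ² + σ²)`. -/
theorem mean_variance_scaled_plugin
    {Ω : Type*} [MeasurableSpace Ω] (P : Measure Ω) [IsProbabilityMeasure P]
    (lam μ σ : ℝ) (hlam : 0 < lam) (hσ : 0 < σ) (N : ℕ) (hN : 1 ≤ N)
    (muHat ΔS : Ω → ℝ) (hIndep : IndepFun muHat ΔS P)
    (hmu : Measure.map muHat P = gaussianReal μ ⟨σ ^ 2 / N, by positivity⟩)
    (hS : Measure.map ΔS P = gaussianReal μ ⟨σ ^ 2, sq_nonneg σ⟩) :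
    ∀ x : ℝ,
      (∫ ω, x * muHat ω * ΔS ω ∂P)
          - lam / 2 * variance (fun ω => x * muHat ω * ΔS ω) P
        = x * μ ^ 2 * (1 - lam * x * σ ^ 2 / 2)
          - lam / (2 * N) * x ^ 2 * σ ^ 2 * (μ ^ 2 + σ ^ 2) := by
  intro x
  obtain ⟨hA, hAL, hA1, hA2⟩ := gaussian_moments_aux P muHat μ _ hmu
  obtain ⟨hB, hBL, hB1, hB2⟩ := gaussian_moments_aux P ΔS μ _ hS
  have hI2 : IndepFun (fun ω => muHat ω ^ 2) (fun ω => ΔS ω ^ 2) P :=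
    hIndep.comp (φ := fun y : ℝ => y ^ 2) (ψ := fun y : ℝ => y ^ 2)
      (by fun_prop) (by fun_prop)
  have e1 : ∫ ω, muHat ω * ΔS ω ∂P = μ * μ := by
    rw [hIndep.integral_fun_mul_eq_mul_integral hA.aestronglyMeasurable
      hB.aestronglyMeasurable, hA1, hB1]
  have e2 : ∫ ω, (muHat ω * ΔS ω) ^ 2 ∂P = (μ ^ 2 + σ ^ 2 / N) * (μ ^ 2 + σ ^ 2) := by
    simp only [mul_pow]
    rw [hI2.integral_fun_mul_eq_mul_integral (hA.pow_const 2).aestronglyMeasurable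
      (hB.pow_const 2).aestronglyMeasurable, hA2, hB2]
    rfl
  have hL : MemLp (fun ω => muHat ω * ΔS ω) 2 P := by
    refine (memLp_two_iff_integrable_sq (hA.mul hB).aestronglyMeasurable).2 ?_
    simp only [Pi.mul_apply, mul_pow]
    exact hI2.integrable_mul hAL.integrable_sq hBL.integrable_sq
  have hv := variance_eq_sub hL
  simp only [Pi.pow_apply] at hv
  rw [e1, e2] at hv
  have hN' : (N : ℝ) ≠ 0 := by positivity
  simp only [mul_assoc x]
  rw [integral_const_mul, variance_const_mul, hv, e1]
  field_simp
  ring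
end

section
/- Let λ > 0, μ ∈ ℝ, σ > 0, N ≥ 1, and let μ̂ and ΔS be independent real random variables with laws Gaussian of mean μ and variance σ²/N, and Gaussian of mean μ and variance σ², respectively. Then the out-of-sample performance of the plug-in strategy a_plug-in = μ̂/(λσ²) satisfies 𝔼[(μ̂/(λσ²))·ΔS] − (λ/2)·Var((μ̂/(λσ²))·ΔS) = μ²/(2λσ²) − (μ² + σ²)/(2Nλσ²). -/
open MeasureTheory ProbabilityTheory
open scoped NNReal

lemma gauss_facts {Ω : Type*} [MeasurableSpace Ω] (P : Measure Ω) [IsProbabilityMeasure P]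
    (X : Ω → ℝ) (m : ℝ) (v : ℝ≥0) (h : Measure.map X P = gaussianReal m v) :
    MemLp X 2 P ∧ ∫ ω, X ω ∂P = m ∧ ∫ ω, X ω ^ 2 ∂P = m ^ 2 + v := by
  have hX : AEMeasurable X P := by
    apply AEMeasurable.of_map_ne_zero
    rw [h]
    exact IsProbabilityMeasure.ne_zero _
  have hL : HasLaw X (gaussianReal m v) P := ⟨hX, h⟩
  have h2 : MemLp X 2 P := by
    have h3 : MemLp id 2 (Measure.map X P) := by
      rw [h]; exact memLp_id_gaussianReal 2
    exact (memLp_map_measure_iff (by fun_prop) hX).1 h3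
  have h1 : ∫ ω, X ω ∂P = m := by
    rw [hL.integral_eq, integral_id_gaussianReal]
  have hv : variance X P = v := by
    rw [hL.variance_eq, variance_id_gaussianReal]
  rw [variance_eq_sub h2, h1] at hv
  refine ⟨h2, h1, ?_⟩
  have : ∫ ω, X ω ^ 2 ∂P - m ^ 2 = v := hv
  linarith

/-- Out-of-sample mean-variance performance of the plug-in strategy
`a_plug-in = μ̂/(λσ²)` equals `μ²/(2λσ²) − (μ² + σ²)/(2Nλσ²)`. -/
theorem oosp_plugin
    {Ω : Type*} [MeasurableSpace Ω] (P : Measure Ω) [IsProbabilityMeasure P]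
    (lam μ σ : ℝ) (hlam : 0 < lam) (hσ : 0 < σ) (N : ℕ) (hN : 1 ≤ N)
    (muHat ΔS : Ω → ℝ) (hIndep : IndepFun muHat ΔS P)
    (hmu : Measure.map muHat P = gaussianReal μ ⟨σ ^ 2 / N, by positivity⟩)
    (hS : Measure.map ΔS P = gaussianReal μ ⟨σ ^ 2, sq_nonneg σ⟩) :
    (∫ ω, muHat ω / (lam * σ ^ 2) * ΔS ω ∂P)
        - lam / 2 * variance (fun ω => muHat ω / (lam * σ ^ 2) * ΔS ω) P
      = μ ^ 2 / (2 * lam * σ ^ 2) - (μ ^ 2 + σ ^ 2) / (2 * N * lam * σ ^ 2) := by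
  obtain ⟨a2, a1, av⟩ := gauss_facts P _ _ _ hmu
  obtain ⟨b2, b1, bv⟩ := gauss_facts P _ _ _ hS
  have hsq : IndepFun (fun ω => muHat ω ^ 2) (fun ω => ΔS ω ^ 2) P :=
    hIndep.comp (φ := fun x : ℝ => x ^ 2) (ψ := fun x : ℝ => x ^ 2) (by fun_prop) (by fun_prop)
  have e1 : ∫ ω, muHat ω * ΔS ω ∂P = μ * μ := by
    rw [hIndep.integral_fun_mul_eq_mul_integral a2.1 b2.1, a1, b1]
  have e2 : ∫ ω, (muHat ω * ΔS ω) ^ 2 ∂P = (μ ^ 2 + σ ^ 2 / N) * (μ ^ 2 + σ ^ 2) := by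
    simp_rw [mul_pow]
    rw [hsq.integral_fun_mul_eq_mul_integral a2.integrable_sq.1 b2.integrable_sq.1, av, bv]
    rfl
  have hm : MemLp (fun ω => muHat ω * ΔS ω) 2 P := by
    refine (memLp_two_iff_integrable_sq (a2.1.mul b2.1)).2 ?_
    simp only [Pi.mul_apply]
    simp_rw [mul_pow]
    exact hsq.integrable_mul a2.integrable_sq b2.integrable_sq
  have hv : variance (fun ω => muHat ω * ΔS ω) P
      = (μ ^ 2 + σ ^ 2 / N) * (μ ^ 2 + σ ^ 2) - (μ * μ) ^ 2 := by
    rw [variance_eq_sub hm, e1, ← e2]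
    rfl
  have hf : (fun ω => muHat ω / (lam * σ ^ 2) * ΔS ω)
      = fun ω => (lam * σ ^ 2)⁻¹ * (muHat ω * ΔS ω) := by
    funext ω; ring
  have hN' : (N : ℝ) ≠ 0 := by positivity
  rw [hf, variance_const_mul, integral_const_mul, e1, hv]
  field_simp
  ring
end

section
/- Let λ > 0, λ' > 0, N ≥ 1, s > 0, μ̂ ∈ ℝ, and let ε be a real random variable whose law is the Gaussian measure on ℝ with mean 0 and variance s/N. Then for every a ∈ ℝ, the outer mean-variance objective of the inner mean-variance value satisfies 𝔼[a·(μ̂ + ε) − (λ/2)·a²·s] − (λ'/2)·Var(a·(μ̂ + ε) − (λ/2)·a²·s) = a·μ̂ − (λ/2)·a²·s·(1 + λ'/(λN)). -/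
open MeasureTheory ProbabilityTheory
open scoped NNReal

/-- With `ε ~ N(0, s/N)`, the outer mean-variance (uncertainty
aversion `λ'`) of the inner mean-variance value `a·(μ̂ + ε) − (λ/2)·a²·s` equals
`a·μ̂ − (λ/2)·a²·s·(1 + λ'/(λN))`. -/
theorem outer_mean_variance_of_inner
    {Ω : Type*} [MeasurableSpace Ω] (P : Measure Ω) [IsProbabilityMeasure P]
    (lam lam' s muHat : ℝ) (hlam : 0 < lam) (hlam' : 0 < lam') (hs : 0 < s)
    (N : ℕ) (hN : 1 ≤ N)
    (ε : Ω → ℝ)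
    (hε : Measure.map ε P = gaussianReal 0 ⟨s / N, by positivity⟩) :
    ∀ a : ℝ,
      (∫ ω, (a * (muHat + ε ω) - lam / 2 * a ^ 2 * s) ∂P)
          - lam' / 2 * variance (fun ω => a * (muHat + ε ω) - lam / 2 * a ^ 2 * s) P
        = a * muHat - lam / 2 * a ^ 2 * s * (1 + lam' / (lam * N)) := by
  intro a
  obtain ⟨v, hv, hε⟩ : ∃ v : ℝ≥0, (v : ℝ) = s / N ∧ Measure.map ε P = gaussianReal 0 v :=
    ⟨_, rfl, hε⟩
  have hm : AEMeasurable ε P := by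
    by_contra h
    rw [Measure.map_of_not_aemeasurable h] at hε
    exact (IsProbabilityMeasure.ne_zero (gaussianReal 0 _)) hε.symm
  have hint : Integrable ε P := by
    have h := (memLp_id_gaussianReal' (μ := 0) (v := v) 1
      (by norm_num)).integrable le_rfl
    rw [← hε] at h
    exact h.comp_aemeasurable hm
  have hmean : ∫ ω, ε ω ∂P = 0 := by
    have h := integral_id_gaussianReal (μ := 0) (v := v)
    rw [← hε, integral_map hm (by fun_prop)] at h
    exact h
  have hvar : variance ε P = s / N := by
    rw [← variance_id_map hm, hε, variance_id_gaussianReal, hv]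
  have h1 : ∫ ω, (a * (muHat + ε ω) - lam / 2 * a ^ 2 * s) ∂P
      = a * muHat - lam / 2 * a ^ 2 * s := by
    have hadd : Integrable (fun ω => a * (muHat + ε ω)) P :=
      ((integrable_const muHat).add hint).const_mul a
    rw [integral_sub hadd (integrable_const _),
      integral_const_mul, integral_add (integrable_const _) hint, hmean]
    simp
  have h2 : variance (fun ω => a * (muHat + ε ω) - lam / 2 * a ^ 2 * s) P
      = a ^ 2 * (s / N) := by
    have hs' : AEStronglyMeasurable ε P := hm.aestronglyMeasurable
    rw [variance_sub_const ((hs'.const_add muHat).const_mul a), variance_const_mul,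
      variance_const_add hs', hvar]
  have hN' : (N : ℝ) ≠ 0 := by positivity
  rw [h1, h2]
  field_simp
  ring
end

section
/- Let λ > 0, s > 0, N ≥ 1, A > 0, and μ̂ ∈ ℝ. Then the function f(a) = a·μ̂ − (λ/2)·a²·s − A·|a|·√(s/N) has the unique maximizer a_u-a' = sign(μ̂)·max(|μ̂| − A·√(s/N), 0)/(λs); in particular a_u-a' = 0 whenever μ̂² ≤ A²·s/N, and otherwise a_u-a' = (μ̂ − sign(μ̂)·A·√(s/N))/(λs). -/
/-- `f(a) = a·μ̂ − (λ/2)·a²·s − A·|a|·√(s/N)` has the unique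
maximizer `a_u-a' = sign(μ̂)·max(|μ̂| − A·√(s/N), 0)/(λs)`; it is `0` whenever
`μ̂² ≤ A²·s/N`, and otherwise equals `(μ̂ − sign(μ̂)·A·√(s/N))/(λs)`. -/
theorem cvar_uncertainty_aware_maximizer
    (lam s A muHat : ℝ) (hlam : 0 < lam) (hs : 0 < s) (hA : 0 < A)
    (N : ℕ) (hN : 1 ≤ N)
    (f : ℝ → ℝ)
    (hf : ∀ a : ℝ, f a = a * muHat - lam / 2 * a ^ 2 * s - A * |a| * Real.sqrt (s / N))
    (aUA : ℝ)
    (haUA : aUA = Real.sign muHat * max (|muHat| - A * Real.sqrt (s / N)) 0 / (lam * s)) :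
    (∀ a : ℝ, f a ≤ f aUA)
    ∧ (∀ a : ℝ, f a = f aUA → a = aUA)
    ∧ (muHat ^ 2 ≤ A ^ 2 * s / N → aUA = 0)
    ∧ (A ^ 2 * s / N < muHat ^ 2
        → aUA = (muHat - Real.sign muHat * (A * Real.sqrt (s / N))) / (lam * s)) := by
  have hN' : (0 : ℝ) < N := by exact_mod_cast hN
  have hTpos : 0 < A * Real.sqrt (s / N) := by positivity
  have hTsq : (A * Real.sqrt (s / N)) ^ 2 = A ^ 2 * s / N := by
    rw [mul_pow, Real.sq_sqrt (by positivity)]; ring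
  have hf' : ∀ a : ℝ, f a = a * muHat - (lam * s) / 2 * a ^ 2 - (A * Real.sqrt (s / N)) * |a| := by
    intro a; rw [hf]; ring
  rw [← hTsq]
  clear hf hTsq
  have hk : 0 < lam * s := by positivity
  generalize A * Real.sqrt (s / N) = T at *
  generalize lam * s = k at *
  have h3 : |muHat| ≤ T → aUA = 0 := by
    intro h
    rw [haUA, max_eq_right (by linarith)]; simp
  have h4 : T < |muHat| → aUA = (muHat - Real.sign muHat * T) / k := by
    intro h
    rw [haUA, max_eq_left (by linarith), mul_sub]
    congr 2
    rcases lt_trichotomy muHat 0 with h0 | h0 | h0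
    · rw [Real.sign_of_neg h0, abs_of_neg h0]; ring
    · simp [h0]
    · rw [Real.sign_of_pos h0, abs_of_pos h0]; ring
  have key : |muHat - k * aUA| ≤ T ∧ (muHat - k * aUA) * aUA = T * |aUA| := by
    rcases le_or_gt (|muHat|) T with h | h
    · rw [h3 h]; simpa using h
    · have hb := h4 h
      rcases lt_or_ge muHat 0 with h0 | h0
      · rw [Real.sign_of_neg h0] at hb
        rw [abs_of_neg h0] at h
        have hkb : k * aUA = muHat + T := by rw [hb]; field_simp; ring
        have hneg : aUA < 0 := by
          rw [hb]; exact div_neg_of_neg_of_pos (by linarith) hk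
        rw [hkb, abs_of_neg hneg]
        refine ⟨?_, by ring⟩
        rw [abs_le]; constructor <;> linarith
      · rw [abs_of_nonneg h0] at h
        rw [Real.sign_of_pos (by linarith)] at hb
        have hkb : k * aUA = muHat - T := by rw [hb]; field_simp
        have hpos : 0 < aUA := by
          rw [hb]; exact div_pos (by linarith) hk
        rw [hkb, abs_of_pos hpos]
        refine ⟨?_, by ring⟩
        rw [abs_le]; constructor <;> linarith
  obtain ⟨k1, k2⟩ := key
  have main : ∀ a : ℝ, f a + k / 2 * (a - aUA) ^ 2 ≤ f aUA := by
    intro a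
    have e : a * (muHat - k * aUA) ≤ T * |a| := by
      calc a * (muHat - k * aUA) ≤ |a * (muHat - k * aUA)| := le_abs_self _
        _ = |muHat - k * aUA| * |a| := by rw [abs_mul, mul_comm]
        _ ≤ T * |a| := by gcongr
    rw [hf', hf']
    linarith
  refine ⟨fun a => ?_, fun a ha => ?_, fun h => h3 ?_, fun h => h4 ?_⟩
  · have := main a
    have : 0 ≤ k / 2 * (a - aUA) ^ 2 := by positivity
    linarith
  · have h := main a
    by_contra hne
    have : 0 < k / 2 * (a - aUA) ^ 2 := by
      have := sub_ne_zero.mpr hne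
      positivity
    linarith
  · exact abs_le_of_sq_le_sq h hTpos.le
  · exact lt_of_pow_lt_pow_left₀ 2 (abs_nonneg _) (by rwa [sq_abs])
end

section
/- Let λ > 0, λ' > 0, μ ∈ ℝ, σ > 0, and let N ≥ 1 be an integer. Set x_N = λN/(λN + λ'), F_u-a = (x_N/(λσ²))·(μ²·(1 − x_N/2) − x_N·(μ² + σ²)/(2N)), and F_plug-in = μ²/(2λσ²) − (μ² + σ²)/(2Nλσ²). Then F_u-a > F_plug-in if and only if μ²·((N − 1)·λ' − 2N·λ)/(2N·λ + λ') < σ². In particular, if λ'·(N − 1) < 2N·λ then F_u-a > F_plug-in. -/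
/-- The uncertainty-aware strategy out-performs the plug-in
strategy iff `μ²·((N−1)·λ' − 2N·λ)/(2N·λ + λ') < σ²`; in particular this holds
whenever `λ'·(N−1) < 2N·λ`. -/
theorem uncertainty_aware_beats_plugin_iff
    (lam lam' μ σ : ℝ) (hlam : 0 < lam) (hlam' : 0 < lam') (hσ : 0 < σ)
    (N : ℕ) (hN : 1 ≤ N)
    (xN FuA Fplugin : ℝ)
    (hxN : xN = lam * N / (lam * N + lam'))
    (hFuA : FuA = xN / (lam * σ ^ 2)
        * (μ ^ 2 * (1 - xN / 2) - xN * (μ ^ 2 + σ ^ 2) / (2 * N)))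
    (hFplugin : Fplugin = μ ^ 2 / (2 * lam * σ ^ 2)
        - (μ ^ 2 + σ ^ 2) / (2 * N * lam * σ ^ 2)) :
    (Fplugin < FuA
      ↔ μ ^ 2 * (((N : ℝ) - 1) * lam' - 2 * N * lam) / (2 * N * lam + lam') < σ ^ 2)
    ∧ (lam' * ((N : ℝ) - 1) < 2 * N * lam → Fplugin < FuA) := by
  have hn : (0 : ℝ) < N := by exact_mod_cast hN
  generalize (N : ℝ) = n at *
  have hD : 0 < lam * n + lam' := by positivity
  have hE : 0 < 2 * n * lam + lam' := by positivity
  have key : FuA - Fplugin = lam' / (2 * lam * σ ^ 2 * n * (lam * n + lam') ^ 2)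
      * (σ ^ 2 * (2 * n * lam + lam') - μ ^ 2 * ((n - 1) * lam' - 2 * n * lam)) := by
    rw [hFuA, hFplugin, hxN]
    field_simp
    ring
  have hc : 0 < lam' / (2 * lam * σ ^ 2 * n * (lam * n + lam') ^ 2) := by positivity
  have main : Fplugin < FuA
      ↔ μ ^ 2 * ((n - 1) * lam' - 2 * n * lam) / (2 * n * lam + lam') < σ ^ 2 := by
    rw [div_lt_iff₀ hE, ← sub_pos, key, mul_pos_iff_of_pos_left hc, sub_pos]
  refine ⟨main, fun h => main.2 ?_⟩
  rw [div_lt_iff₀ hE]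
  have h1 : 0 < σ ^ 2 * (2 * n * lam + lam') := by positivity
  have h2 : 0 ≤ μ ^ 2 * (2 * n * lam - lam' * (n - 1)) :=
    mul_nonneg (sq_nonneg μ) (by linarith)
  linarith
end

section
/- Let d ≥ 1, let Σ be a positive definite real d × d matrix, let μ̂ ∈ ℝ^d, λ > 0, κ > 0, N > 0, and set m = √(μ̂ᵀΣ⁻¹μ̂). Define J̃(a) = aᵀμ̂ − κ·√(aᵀΣa/N) − (λ/2)·aᵀΣa for a ∈ ℝ^d. Then J̃ has the unique maximizer a* = (1/λ)·max(1 − κ/(√N·m), 0)·Σ⁻¹μ̂ (interpreted as a* = 0 when μ̂ = 0). In particular, a* = 0 if and only if m ≤ κ/√N, and otherwise a* points along Σ⁻¹μ̂ with shrinkage factor (1 − κ/(√N·m))/λ. -/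
open Matrix

/-- The CVaR uncertainty-aware objective
`J̃(a) = aᵀμ̂ − κ·√(aᵀΣa/N) − (λ/2)·aᵀΣa` has the unique maximizer
`a* = (1/λ)·max(1 − κ/(√N·m), 0)·Σ⁻¹μ̂` with `m = √(μ̂ᵀΣ⁻¹μ̂)`; moreover `a* = 0`
iff `m ≤ κ/√N`, and otherwise `a*` points along `Σ⁻¹μ̂` with shrinkage factor
`(1 − κ/(√N·m))/λ`. -/
theorem cvar_high_dim_unique_maximizer
    (d : ℕ) (hd : 1 ≤ d)
    (S : Matrix (Fin d) (Fin d) ℝ) (hS : S.PosDef)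
    (muHat : Fin d → ℝ) (lam κ N : ℝ) (hlam : 0 < lam) (hκ : 0 < κ) (hN : 0 < N)
    (m : ℝ) (hm : m = Real.sqrt (muHat ⬝ᵥ (S⁻¹ *ᵥ muHat)))
    (J : (Fin d → ℝ) → ℝ)
    (hJ : ∀ a : Fin d → ℝ,
      J a = a ⬝ᵥ muHat - κ * Real.sqrt ((a ⬝ᵥ (S *ᵥ a)) / N)
            - lam / 2 * (a ⬝ᵥ (S *ᵥ a)))
    (aStar : Fin d → ℝ)
    (haStar : aStar = ((1 / lam) * max (1 - κ / (Real.sqrt N * m)) 0) • (S⁻¹ *ᵥ muHat)) :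
    (∀ a : Fin d → ℝ, J a ≤ J aStar)
    ∧ (∀ a : Fin d → ℝ, J a = J aStar → a = aStar)
    ∧ (aStar = 0 ↔ m ≤ κ / Real.sqrt N)
    ∧ (κ / Real.sqrt N < m
        → aStar = ((1 - κ / (Real.sqrt N * m)) / lam) • (S⁻¹ *ᵥ muHat)) := by
  have hsym : ∀ x y : Fin d → ℝ, x ⬝ᵥ (S *ᵥ y) = y ⬝ᵥ (S *ᵥ x) := by
    intro x y
    have hT : Sᵀ = S := by
      have h := hS.isHermitian
      rwa [Matrix.IsHermitian, Matrix.conjTranspose_eq_transpose_of_trivial] at h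
    rw [Matrix.dotProduct_mulVec, ← Matrix.mulVec_transpose, hT, dotProduct_comm]
  have hpos : ∀ x : Fin d → ℝ, x ≠ 0 → 0 < x ⬝ᵥ (S *ᵥ x) := by
    intro x hx
    have h := hS.dotProduct_mulVec_pos hx
    simpa using h
  have hnn : ∀ x : Fin d → ℝ, 0 ≤ x ⬝ᵥ (S *ᵥ x) := by
    intro x
    by_cases hx : x = 0
    · simp [hx]
    · exact (hpos x hx).le
  obtain ⟨v, hv⟩ : ∃ v, v = S⁻¹ *ᵥ muHat := ⟨_, rfl⟩
  have hSv : S *ᵥ v = muHat := by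
    have hu : IsUnit S.det := hS.det_pos.ne'.isUnit
    rw [hv, Matrix.mulVec_mulVec, Matrix.mul_nonsing_inv _ hu, Matrix.one_mulVec]
  rw [← hv] at haStar hm ⊢
  rw [← hSv] at hm
  have hm0 : 0 ≤ m := hm ▸ Real.sqrt_nonneg _
  have hm2 : m ^ 2 = v ⬝ᵥ (S *ᵥ v) := by
    rw [hm, dotProduct_comm, Real.sq_sqrt (hnn v)]
  have hquad : ∀ (x y : Fin d → ℝ) (p q : ℝ), (p • x - q • y) ⬝ᵥ (S *ᵥ (p • x - q • y))
      = p ^ 2 * (x ⬝ᵥ (S *ᵥ x)) - 2 * p * q * (x ⬝ᵥ (S *ᵥ y)) + q ^ 2 * (y ⬝ᵥ (S *ᵥ y)) := by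
    intro x y p q
    simp only [Matrix.mulVec_sub, Matrix.mulVec_smul, sub_dotProduct, dotProduct_sub,
      smul_dotProduct, dotProduct_smul, smul_eq_mul]
    rw [hsym y x]
    ring
  have hsN : 0 < Real.sqrt N := Real.sqrt_pos.mpr hN
  obtain ⟨k, hk⟩ : ∃ k, k = κ / Real.sqrt N := ⟨_, rfl⟩
  have hk0 : 0 < k := hk ▸ div_pos hκ hsN
  have hkm : κ / (Real.sqrt N * m) = k / m := by rw [hk, div_div]
  rw [hkm] at haStar ⊢
  rw [← hk]
  have hJ' : ∀ (a : Fin d → ℝ) (s : ℝ), 0 ≤ s → s ^ 2 = a ⬝ᵥ (S *ᵥ a) →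
      J a = a ⬝ᵥ (S *ᵥ v) - k * s - lam / 2 * s ^ 2 := by
    intro a s hs hs2
    rw [hJ, hSv, ← hs2, Real.sqrt_div (sq_nonneg s), Real.sqrt_sq hs, hk]
    ring
  have hCS : ∀ (a : Fin d → ℝ) (s : ℝ), 0 ≤ s → s ^ 2 = a ⬝ᵥ (S *ᵥ a) →
      a ⬝ᵥ (S *ᵥ v) ≤ m * s := by
    intro a s hs hs2
    by_cases ha : a = 0
    · simp only [ha, zero_dotProduct]; positivity
    by_cases hv0 : v = 0
    · simp only [hv0, Matrix.mulVec_zero, dotProduct_zero]; positivity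
    have h1 : 0 < s := by
      have := hpos a ha
      rw [← hs2] at this
      exact lt_of_le_of_ne hs (Ne.symm (sq_pos_iff.mp this))
    have h2 : 0 < m := by
      have := hpos v hv0
      rw [← hm2] at this
      exact lt_of_le_of_ne hm0 (Ne.symm (sq_pos_iff.mp this))
    have h3 := hnn (m • a - s • v)
    rw [hquad, ← hs2, ← hm2] at h3
    have h4 : 0 < m * s := mul_pos h2 h1
    by_contra! h5
    nlinarith [mul_lt_mul_of_pos_left h5 h4]
  have hv0 : m = 0 → v = 0 := by
    intro h
    by_contra h'
    have := hpos v h'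
    rw [← hm2, h] at this
    norm_num at this
  have hsmall : m ≤ k → aStar = 0 := by
    intro h
    rw [haStar]
    rcases hm0.eq_or_lt with h0 | h0
    · rw [hv0 h0.symm, smul_zero]
    · have : 1 ≤ k / m := by rwa [one_le_div h0]
      rw [max_eq_right (by linarith), mul_zero, zero_smul]
  have hbig : k < m → aStar = ((1 - k / m) / lam) • v := by
    intro h
    have h0 : 0 < m := hk0.trans h
    have : k / m < 1 := by rwa [div_lt_one h0]
    rw [haStar, max_eq_left (by linarith)]
    congr 1
    ring
  have key : ∀ a, lam / 2 * ((a - aStar) ⬝ᵥ (S *ᵥ (a - aStar))) ≤ J aStar - J a := by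
    intro a
    have hs := Real.sqrt_nonneg (a ⬝ᵥ (S *ᵥ a))
    have hs2 := Real.sq_sqrt (hnn a)
    generalize Real.sqrt (a ⬝ᵥ (S *ᵥ a)) = s at hs hs2
    have hc := hCS a s hs hs2
    rw [hJ' a s hs hs2]
    rcases le_or_gt m k with h | h
    · rw [hsmall h, hJ' 0 0 le_rfl (by simp), sub_zero, ← hs2, zero_dotProduct]
      nlinarith [mul_le_mul_of_nonneg_right h hs]
    · have h0 : 0 < m := hk0.trans h
      have h1 : k / m < 1 := by rwa [div_lt_one h0]
      obtain ⟨r, hr⟩ : ∃ r, r = k / m := ⟨_, rfl⟩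
      have hkr : k = r * m := by rw [hr]; field_simp
      have hr0 : 0 < r := hr ▸ div_pos hk0 h0
      obtain ⟨c, hcd⟩ : ∃ c, c = (1 - r) / lam := ⟨_, rfl⟩
      have hc0 : 0 < c := by rw [hcd]; exact div_pos (by linarith) hlam
      have hlc : lam * c = 1 - r := by rw [hcd]; field_simp
      have hq := hquad a v 1 c
      rw [one_smul, ← hs2, ← hm2] at hq
      have hst : aStar = c • v := by rw [hbig h, hcd, hr]
      rw [hst, hJ' (c • v) (c * m) (by positivity) (by
        rw [Matrix.mulVec_smul, smul_dotProduct, dotProduct_smul, ← hm2, smul_eq_mul, smul_eq_mul]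
        ring), hq, smul_dotProduct, smul_eq_mul, ← hm2, hkr]
      have hrr : r = 1 - lam * c := by linarith
      have h6 := mul_le_mul_of_nonneg_left hc hr0.le
      rw [hrr] at h6 ⊢
      nlinarith
  refine ⟨fun a => ?_, fun a ha => ?_, ⟨fun h => ?_, hsmall⟩, hbig⟩
  · have h1 := key a
    have h2 := mul_nonneg (half_pos hlam).le (hnn (a - aStar))
    linarith
  · by_contra hne
    have h1 := key a
    have h2 := mul_pos (half_pos hlam) (hpos (a - aStar) (sub_ne_zero.mpr hne))
    linarith
  · by_contra! hlt
    have h0 : 0 < m := hk0.trans hlt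
    have h1 : k / m < 1 := by rwa [div_lt_one h0]
    rw [hbig hlt, smul_eq_zero] at h
    rcases h with h | h
    · have : 0 < (1 - k / m) / lam := div_pos (by linarith) hlam
      linarith
    · rw [h] at hm2
      simp at hm2
      linarith
end

section
/- Let (Ω, ℱ, ℙ) be a probability space, let E be a real normed vector space, let α ∈ (0, 1], and let f : E × Ω → ℝ be such that for every ω ∈ Ω the function φ ↦ f(φ, ω) is convex on E, and for every φ ∈ E the function ω ↦ f(φ, ω) is integrable. Define g : E → ℝ by g(φ) = inf over ζ ∈ ℝ of ( ζ + (1/α)·∫ max(f(φ, ω) − ζ, 0) dℙ(ω) ). Then for every φ the infimum defining g(φ) is finite, and g is convex on E. -/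
open MeasureTheory

/-- The Rockafellar–Uryasev CVaR objective
`g(φ) = inf_ζ ( ζ + (1/α)·𝔼[(f(φ,·) − ζ)⁺] )` is finite (the infimum is over a
set bounded below) and convex in `φ` when `f` is convex in `φ` and integrable. -/
theorem cvar_ru_convex
    {Ω : Type*} [MeasurableSpace Ω] (P : Measure Ω) [IsProbabilityMeasure P]
    {E : Type*} [NormedAddCommGroup E] [NormedSpace ℝ E]
    (α : ℝ) (hα : α ∈ Set.Ioc (0 : ℝ) 1)
    (f : E → Ω → ℝ)
    (hconv : ∀ ω : Ω, ConvexOn ℝ Set.univ (fun φ => f φ ω))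
    (hint : ∀ φ : E, Integrable (f φ) P)
    (g : E → ℝ)
    (hg : ∀ φ : E, g φ = ⨅ ζ : ℝ, (ζ + (1 / α) * ∫ ω, max (f φ ω - ζ) 0 ∂P)) :
    (∀ φ : E, BddBelow
        (Set.range fun ζ : ℝ => ζ + (1 / α) * ∫ ω, max (f φ ω - ζ) 0 ∂P))
    ∧ ConvexOn ℝ Set.univ g := by
  obtain ⟨hα0, hα1⟩ := hα
  have hα' : 1 ≤ 1 / α := by rw [le_div_iff₀ hα0]; linarith
  have hI : ∀ (φ : E) (ζ : ℝ), Integrable (fun ω => f φ ω - ζ) P :=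
    fun φ ζ => (hint φ).sub (integrable_const ζ)
  have hM : ∀ (φ : E) (ζ : ℝ), Integrable (fun ω => max (f φ ω - ζ) 0) P :=
    fun φ ζ => (hI φ ζ).pos_part
  have hB : ∀ φ : E, BddBelow
      (Set.range fun ζ : ℝ => ζ + (1 / α) * ∫ ω, max (f φ ω - ζ) 0 ∂P) := by
    intro φ
    refine ⟨∫ ω, f φ ω ∂P, ?_⟩
    rintro _ ⟨ζ, rfl⟩
    have h0 : 0 ≤ ∫ ω, max (f φ ω - ζ) 0 ∂P := integral_nonneg fun ω => le_max_right _ _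
    have h1 : ∫ ω, (f φ ω - ζ) ∂P ≤ ∫ ω, max (f φ ω - ζ) 0 ∂P :=
      integral_mono (hI φ ζ) (hM φ ζ) fun ω => le_max_left _ _
    rw [integral_sub (hint φ) (integrable_const ζ)] at h1
    simp only [integral_const, probReal_univ, one_smul] at h1
    have h2 := mul_le_mul_of_nonneg_right hα' h0
    show _ ≤ ζ + (1 / α) * ∫ ω, max (f φ ω - ζ) 0 ∂P
    linarith
  refine ⟨hB, convex_univ, ?_⟩
  intro x _ y _ a b ha hb hab
  simp only [smul_eq_mul]
  refine le_of_forall_pos_le_add fun ε hε => ?_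
  obtain ⟨z, hz⟩ := exists_lt_of_ciInf_lt (show _ < g x + ε by rw [hg x]; exact lt_add_of_pos_right _ hε)
  obtain ⟨w, hw⟩ := exists_lt_of_ciInf_lt (show _ < g y + ε by rw [hg y]; exact lt_add_of_pos_right _ hε)
  have h1 : g (a • x + b • y) ≤ (a * z + b * w) +
      (1 / α) * ∫ ω, max (f (a • x + b • y) ω - (a * z + b * w)) 0 ∂P := by
    rw [hg]
    exact ciInf_le (hB _) (a * z + b * w)
  have h2 : ∫ ω, max (f (a • x + b • y) ω - (a * z + b * w)) 0 ∂P ≤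
      a * ∫ ω, max (f x ω - z) 0 ∂P + b * ∫ ω, max (f y ω - w) 0 ∂P := by
    rw [← integral_const_mul, ← integral_const_mul,
      ← integral_add ((hM x z).const_mul a) ((hM y w).const_mul b)]
    refine integral_mono (hM _ _) (((hM x z).const_mul a).add ((hM y w).const_mul b)) fun ω => ?_
    have hc := (hconv ω).2 (Set.mem_univ x) (Set.mem_univ y) ha hb hab
    simp only [smul_eq_mul] at hc
    have e1 := mul_le_mul_of_nonneg_left (le_max_left (f x ω - z) 0) ha
    have e2 := mul_le_mul_of_nonneg_left (le_max_left (f y ω - w) 0) hb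
    have e3 := mul_nonneg ha (le_max_right (f x ω - z) 0)
    have e4 := mul_nonneg hb (le_max_right (f y ω - w) 0)
    exact max_le (by linarith) (by linarith)
  have h3 := mul_le_mul_of_nonneg_left h2 (zero_le_one.trans hα')
  have h4 := mul_le_mul_of_nonneg_left hz.le ha
  have h5 := mul_le_mul_of_nonneg_left hw.le hb
  have h6 : a * ε + b * ε = ε := by rw [← add_mul, hab, one_mul]
  linarith
end
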